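/- For every measurable set Λ ⊆ ℝ^d of finite Lebesgue measure, the radius of convergence of the complex power series z ↦ Σ_{n≥1} (z^n/n!) ∫_{Λ^n} ω^T_n(x_1,…,x_n) dx_1⋯dx_n is at least sup_{μ>0} μ/Ψ(μ). -/

import Mathlib

open MeasureTheory ENNReal
open scoped Classical

noncomputable section

/-- Pair weight `w(x,y) = exp(-β φ(x-y))`, with `exp(-(+∞)) = 0`. -/
def pairW {d : ℕ} (β : ℝ) (φ : (Fin d → ℝ) → ℝ≥0∞) (x y : Fin d → ℝ) : ℝ :=
  if φ (x - y) = ∞ then 0 else Real.exp (-(β * (φ (x - y)).toReal))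

/-- Truncated weight `ω^T_n`: sum over connected graphs on `{1,…,n}`. -/
def omegaT {S : Type*} (w : S → S → ℝ) (n : ℕ) (x : Fin n → S) : ℝ :=
  ∑ G : SimpleGraph (Fin n),
    if G.Connected then
      ∏ p ∈ Finset.univ.filter (fun p : Fin n × Fin n => p.1 < p.2 ∧ G.Adj p.1 p.2),
        (w (x p.1) (x p.2) - 1)
    else 0

/-- `φ_n(x; x_1,…,x_n) = Π_i (1 - w(x,x_i)) Π_{i<j} w(x_i,x_j)`. -/
def phiVertex {S : Type*} (w : S → S → ℝ) (n : ℕ) (x : S) (y : Fin n → S) : ℝ :=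
  (∏ i, (1 - w x (y i))) *
    ∏ p ∈ Finset.univ.filter (fun p : Fin n × Fin n => p.1 < p.2), w (y p.1) (y p.2)

/-- `g(n) = ∫_{ℝ^{dn}} φ_n(0; x_1,…,x_n) dx`. -/
def gCoef {d : ℕ} (β : ℝ) (φ : (Fin d → ℝ) → ℝ≥0∞) (n : ℕ) : ℝ≥0∞ :=
  ∫⁻ y : Fin n → Fin d → ℝ, ENNReal.ofReal (phiVertex (pairW β φ) n 0 y)

/-- The vertex sum `Ψ(t) = 1 + Σ_{n≥1} g(n) t^n/n!` (extended to `t ∈ [0,∞]`). -/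
def vertexSum {d : ℕ} (β : ℝ) (φ : (Fin d → ℝ) → ℝ≥0∞) (t : ℝ≥0∞) : ℝ≥0∞ :=
  1 + ∑' n : ℕ, gCoef β φ (n + 1) * t ^ (n + 1) / ((n + 1).factorial : ℝ≥0∞)


section Graphs

variable {ι : Type*}

/-- The graph obtained from `G` by joining `v` to every vertex of `M`. -/
def addStar (v : ι) (M : Finset ι) (G : SimpleGraph ι) : SimpleGraph ι where
  Adj a b := G.Adj a b ∨ (a = v ∧ b ∈ M ∧ a ≠ b) ∨ (b = v ∧ a ∈ M ∧ a ≠ b)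
  symm := ⟨by
    rintro a b (h | ⟨h, h', h''⟩ | ⟨h, h', h''⟩)
    · exact Or.inl h.symm
    · exact Or.inr (Or.inr ⟨h, h', h''.symm⟩)
    · exact Or.inr (Or.inl ⟨h, h', h''.symm⟩)⟩
  loopless := ⟨by
    rintro a (h | ⟨-, -, h⟩ | ⟨-, -, h⟩)
    · exact G.loopless.irrefl a h
    · exact h rfl
    · exact h rfl⟩

/-- The graph obtained from `G` by removing all edges at `v`. -/
def isolateVertex (v : ι) (G : SimpleGraph ι) : SimpleGraph ι where
  Adj a b := G.Adj a b ∧ a ≠ v ∧ b ≠ v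
  symm := ⟨fun _ _ h => ⟨h.1.symm, h.2.2, h.2.1⟩⟩
  loopless := ⟨fun a h => G.loopless.irrefl a h.1⟩

/-- The complete graph on the vertices of `A`. -/
def cliqueOn (A : Finset ι) : SimpleGraph ι where
  Adj a b := a ≠ b ∧ a ∈ A ∧ b ∈ A
  symm := ⟨fun _ _ h => ⟨h.1.symm, h.2.2, h.2.1⟩⟩
  loopless := ⟨fun _ h => h.1 rfl⟩

theorem cliqueOn_insert [DecidableEq ι] (v : ι) (A : Finset ι) :
    cliqueOn (insert v A) = addStar v A (cliqueOn A) := by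
  ext a b
  simp only [cliqueOn, addStar, Finset.mem_insert]
  grind

variable [Fintype ι] [LinearOrder ι]

/-- The product of `f a b` over the edges `a < b` of `G`. -/
def pairProd {M : Type*} [CommMonoid M] (f : ι → ι → M) (G : SimpleGraph ι) : M :=
  ∏ p ∈ Finset.univ.filter (fun p : ι × ι => p.1 < p.2 ∧ G.Adj p.1 p.2), f p.1 p.2

theorem pairProd_addStar {M : Type*} [CommMonoid M] (f : ι → ι → M) (hf : ∀ a b, f a b = f b a)
    (v : ι) (N : Finset ι) (hv : v ∉ N) (G : SimpleGraph ι) (hG : ∀ a, ¬ G.Adj v a) :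
    pairProd f (addStar v N G) = (∏ m ∈ N, f v m) * pairProd f G := by
  unfold pairProd
  have hG' : ∀ a, ¬ G.Adj a v := fun a h => hG a h.symm
  rw [← Finset.prod_filter_mul_prod_filter_not _ (fun p : ι × ι => p.1 = v ∨ p.2 = v)]
  congr 1
  · refine Finset.prod_bij' (fun p _ => if p.1 = v then p.2 else p.1)
      (fun m _ => if v < m then (v, m) else (m, v)) ?_ ?_ ?_ ?_ ?_
    · rintro ⟨a, b⟩ h
      simp only [Finset.mem_filter, addStar] at h
      grind
    · intro m hm
      have : m ≠ v := fun h => hv (h ▸ hm)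
      rw [Finset.mem_filter, Finset.mem_filter]
      rcases lt_or_gt_of_ne this with h | h
      · simp [addStar, h, h.not_gt, hm, this]
      · simp [addStar, h, hm, this.symm]
    · rintro ⟨a, b⟩ h
      simp only [Finset.mem_filter, addStar] at h
      grind
    · intro m hm
      have : m ≠ v := fun h => hv (h ▸ hm)
      split_ifs <;> simp_all
    · rintro ⟨a, b⟩ h
      simp only [Finset.mem_filter, addStar] at h
      grind
  · refine Finset.prod_congr ?_ fun _ _ => rfl
    ext ⟨a, b⟩
    simp only [Finset.mem_filter, Finset.mem_univ, true_and, addStar]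
    have h1 := hG b
    have h2 := hG' a
    grind

/-- The graphs on the vertex set `A` in which every vertex is connected to a vertex of `J`. -/
def rootedGraphs (A J : Finset ι) : Finset (SimpleGraph ι) :=
  Finset.univ.filter fun G => (∀ a b, G.Adj a b → a ∈ A) ∧ ∀ a ∈ A, ∃ j ∈ J, G.Reachable a j

theorem addStar_mem_rootedGraphs {A J N K : Finset ι} {v : ι} (hJA : J ⊆ A) (hv : v ∈ J)
    (hN : N ⊆ J.erase v) (hK : K ⊆ A \ J) {G : SimpleGraph ι}
    (hG : G ∈ rootedGraphs (A.erase v) (J.erase v ∪ K)) :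
    addStar v (N ∪ K) G ∈ rootedGraphs A J := by
  simp only [rootedGraphs, Finset.mem_filter, Finset.mem_univ, true_and] at hG ⊢
  refine ⟨?_, ?_⟩
  · rintro a b (h | ⟨h, -, -⟩ | ⟨-, h, -⟩)
    · exact Finset.mem_of_mem_erase (hG.1 a b h)
    · exact h ▸ hJA hv
    · grind
  · intro a ha
    by_cases hav : a = v
    · exact ⟨v, hv, hav ▸ SimpleGraph.Reachable.refl _⟩
    obtain ⟨j, hj, hr⟩ := hG.2 a (Finset.mem_erase.2 ⟨hav, ha⟩)
    have hle : G ≤ addStar v (N ∪ K) G := fun a b h => Or.inl h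
    rcases Finset.mem_union.1 hj with hj | hj
    · exact ⟨j, Finset.mem_of_mem_erase hj, hr.mono hle⟩
    · refine ⟨v, hv, (hr.mono hle).trans (SimpleGraph.Adj.reachable ?_)⟩
      refine Or.inr (Or.inr ⟨rfl, Finset.mem_union_right _ hj, ?_⟩)
      exact fun h => (Finset.mem_sdiff.1 (hK hj)).2 (h ▸ hv)

theorem isolateVertex_mem_rootedGraphs {A J : Finset ι} {v : ι} {G : SimpleGraph ι}
    (hG : G ∈ rootedGraphs A J) :
    isolateVertex v G ∈ rootedGraphs (A.erase v)
      (J.erase v ∪ (A \ J).filter (fun a => G.Adj v a)) := by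
  simp only [rootedGraphs, Finset.mem_filter, Finset.mem_univ, true_and] at hG ⊢
  refine ⟨fun a b h => Finset.mem_erase.2 ⟨h.2.1, hG.1 a b h.1⟩, ?_⟩
  intro a ha
  obtain ⟨j, hj, ⟨p⟩⟩ := hG.2 a (Finset.mem_of_mem_erase ha)
  induction p with
  | nil => exact ⟨_, Finset.mem_union_left _ (Finset.mem_erase.2 ⟨Finset.ne_of_mem_erase ha, hj⟩),
      SimpleGraph.Reachable.refl _⟩
  | @cons a b c h p ih =>
    have hav := Finset.ne_of_mem_erase ha
    by_cases hb : b = v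
    · subst hb
      refine ⟨a, ?_, SimpleGraph.Reachable.refl _⟩
      have := h.symm
      grind
    · obtain ⟨r, hr, hbr⟩ := ih (Finset.mem_erase.2 ⟨hb, hG.1 b a h.symm⟩) hj
      have hab : (isolateVertex v G).Adj a b := ⟨h, hav, hb⟩
      exact ⟨r, hr, hab.reachable.trans hbr⟩

theorem sum_rootedGraphs {R : Type*} [AddCommMonoid R] (F : SimpleGraph ι → R)
    {A J : Finset ι} {v : ι} (hJA : J ⊆ A) (hv : v ∈ J) :
    ∑ G ∈ rootedGraphs A J, F G =
      ∑ N ∈ (J.erase v).powerset, ∑ K ∈ (A \ J).powerset,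
        ∑ G ∈ rootedGraphs (A.erase v) (J.erase v ∪ K), F (addStar v (N ∪ K) G) := by
  simp_rw [Finset.sum_sigma']
  symm
  refine Finset.sum_bij' (fun q _ => addStar v (q.1 ∪ q.2.1) q.2.2)
    (fun G _ => ⟨(J.erase v).filter (fun a => G.Adj v a),
      ⟨(A \ J).filter (fun a => G.Adj v a), isolateVertex v G⟩⟩) ?_ ?_ ?_ ?_ ?_
  · rintro ⟨N, K, G⟩ h
    simp only [Finset.mem_sigma, Finset.mem_powerset] at h
    exact addStar_mem_rootedGraphs hJA hv h.1 h.2.1 h.2.2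
  · intro G hG
    simp only [Finset.mem_sigma, Finset.mem_powerset]
    exact ⟨Finset.filter_subset _ _, Finset.filter_subset _ _, isolateVertex_mem_rootedGraphs hG⟩
  · rintro ⟨N, K, G⟩ h
    simp only [Finset.mem_sigma, Finset.mem_powerset] at h
    obtain ⟨hN, hK, hG⟩ := h
    simp only [rootedGraphs, Finset.mem_filter, Finset.mem_univ, true_and] at hG
    have hGv : ∀ a, ¬ G.Adj v a := fun a h => Finset.notMem_erase v A (hG.1 v a h)
    have hGv' : ∀ a, ¬ G.Adj a v := fun a h => hGv a h.symm
    have e1 : (J.erase v).filter (fun a => (addStar v (N ∪ K) G).Adj v a) = N := by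
      ext a
      have := hGv a
      simp only [addStar, Finset.mem_filter]
      grind
    have e2 : (A \ J).filter (fun a => (addStar v (N ∪ K) G).Adj v a) = K := by
      ext a
      have := hGv a
      simp only [addStar, Finset.mem_filter]
      grind
    have e3 : isolateVertex v (addStar v (N ∪ K) G) = G := by
      ext a b
      have := hGv b
      have := hGv' a
      simp only [addStar, isolateVertex]
      grind
    simp only [e1, e2, e3]
  · intro G hG
    simp only [rootedGraphs, Finset.mem_filter, Finset.mem_univ, true_and] at hG
    have h1 : ∀ a b, G.Adj a b → b ∈ A := fun a b h => hG.1 b a h.symm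
    have h2 : ∀ a b, G.Adj a b → a ≠ b := fun a b h => h.ne
    ext a b
    have := hG.1 a b
    have := h1 a b
    have := h2 a b
    have := G.adj_comm a b
    simp only [addStar, isolateVertex, Finset.mem_union, Finset.mem_filter]
    grind
  · intro _ _
    rfl

/-- The sum over graphs on `A`, each component of which meets `J`, of the product of the
Mayer factors `w - 1`. -/
def rootedSum {S : Type*} (w : S → S → ℝ) (A J : Finset ι) (x : ι → S) : ℝ :=
  ∑ G ∈ rootedGraphs A J, pairProd (fun a b => w (x a) (x b) - 1) G

/-- The Kirkwood–Salsburg recursion. -/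
theorem rootedSum_eq {S : Type*} (w : S → S → ℝ) (hw : ∀ s t, w s t = w t s) {A J : Finset ι}
    {v : ι} (hJA : J ⊆ A) (hv : v ∈ J) (x : ι → S) :
    rootedSum w A J x = (∏ j ∈ J.erase v, w (x v) (x j)) *
      ∑ K ∈ (A \ J).powerset, (∏ k ∈ K, (w (x v) (x k) - 1)) *
        rootedSum w (A.erase v) (J.erase v ∪ K) x := by
  unfold rootedSum
  rw [sum_rootedGraphs _ hJA hv]
  have h1 : (∏ j ∈ J.erase v, w (x v) (x j)) =
      ∑ N ∈ (J.erase v).powerset, ∏ j ∈ N, (w (x v) (x j) - 1) := by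
    rw [← Finset.prod_add_one]
    simp
  rw [h1, Finset.sum_mul]
  refine Finset.sum_congr rfl fun N hN => ?_
  rw [Finset.mul_sum]
  refine Finset.sum_congr rfl fun K hK => ?_
  rw [Finset.mul_sum, Finset.mul_sum]
  refine Finset.sum_congr rfl fun G hG => ?_
  rw [Finset.mem_powerset] at hN hK
  simp only [rootedGraphs, Finset.mem_filter, Finset.mem_univ, true_and] at hG
  rw [pairProd_addStar _ (fun a b => by rw [hw]) v (N ∪ K) (by grind) G
    (fun a h => Finset.notMem_erase v A (hG.1 v a h)), Finset.prod_union, mul_assoc]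
  exact Finset.disjoint_left.2 fun a ha hb => by grind

end Graphs

section KirkwoodSalsburg

variable {ι S : Type*} [Fintype ι] [LinearOrder ι]

/-- The Boltzmann weight of the points labelled by `J`. -/
def boltzmannWeight (w : S → S → ℝ) (J : Finset ι) (x : ι → S) : ℝ≥0∞ :=
  pairProd (fun a b => ENNReal.ofReal (w (x a) (x b))) (cliqueOn J)

theorem boltzmannWeight_insert {w : S → S → ℝ} (hw : ∀ s t, w s t = w t s) {v : ι} {A : Finset ι}
    (hv : v ∉ A) (x : ι → S) :
    boltzmannWeight w (insert v A) x =
      (∏ a ∈ A, ENNReal.ofReal (w (x v) (x a))) * boltzmannWeight w A x := by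
  unfold boltzmannWeight
  rw [cliqueOn_insert, pairProd_addStar _ (fun a b => by rw [hw]) v A hv]
  exact fun a h => hv h.2.1

theorem boltzmannWeight_congr (w : S → S → ℝ) {A : Finset ι} {x y : ι → S}
    (h : ∀ a ∈ A, x a = y a) : boltzmannWeight w A x = boltzmannWeight w A y := by
  unfold boltzmannWeight pairProd
  refine Finset.prod_congr rfl fun p hp => ?_
  rw [Finset.mem_filter] at hp
  simp only [h _ hp.2.2.2.1, h _ hp.2.2.2.2]

theorem boltzmannWeight_union_le {w : S → S → ℝ} (hw1 : ∀ s t, w s t ≤ 1) {J K : Finset ι}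
    (hJK : Disjoint J K) (x : ι → S) :
    boltzmannWeight w (J ∪ K) x ≤ boltzmannWeight w J x * boltzmannWeight w K x := by
  unfold boltzmannWeight pairProd
  rw [← Finset.prod_union]
  · refine Finset.prod_le_prod_of_subset_of_le_one' ?_ ?_
    · rintro ⟨a, b⟩ h
      simp only [Finset.mem_union, Finset.mem_filter, Finset.mem_univ, true_and, cliqueOn] at h ⊢
      grind
    · intro p _ _
      exact ENNReal.ofReal_le_one.2 (hw1 _ _)
  · refine Finset.disjoint_left.2 ?_
    rintro ⟨a, b⟩ h h'
    rw [Finset.mem_filter] at h h'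
    exact Finset.disjoint_left.1 hJK h.2.2.2.1 h'.2.2.2.1

/-- The product of the factors `1 - w` joining `v` to the points of `K`. -/
def starWeight (w : S → S → ℝ) (v : ι) (K : Finset ι) (x : ι → S) : ℝ≥0∞ :=
  ∏ k ∈ K, ENNReal.ofReal (1 - w (x v) (x k))

theorem ofReal_phiVertex {w : S → S → ℝ} (hw0 : ∀ s t, 0 ≤ w s t) (hw1 : ∀ s t, w s t ≤ 1)
    (n : ℕ) (s : S) (y : Fin n → S) :
    ENNReal.ofReal (phiVertex w n s y) = (∏ i, ENNReal.ofReal (1 - w s (y i))) *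
      ∏ p ∈ Finset.univ.filter (fun p : Fin n × Fin n => p.1 < p.2),
        ENNReal.ofReal (w (y p.1) (y p.2)) := by
  unfold phiVertex
  rw [ENNReal.ofReal_mul (Finset.prod_nonneg fun i _ => sub_nonneg.2 (hw1 _ _)),
    ENNReal.ofReal_prod_of_nonneg fun i _ => sub_nonneg.2 (hw1 _ _),
    ENNReal.ofReal_prod_of_nonneg fun i _ => hw0 _ _]

theorem enorm_rootedSum_le {w : S → S → ℝ} (hw : ∀ s t, w s t = w t s)
    (hw0 : ∀ s t, 0 ≤ w s t) (hw1 : ∀ s t, w s t ≤ 1) {A J : Finset ι} {v : ι} (hJA : J ⊆ A)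
    (hv : v ∈ J) (x : ι → S) :
    ‖rootedSum w A J x‖ₑ ≤ (∏ j ∈ J.erase v, ENNReal.ofReal (w (x v) (x j))) *
      ∑ K ∈ (A \ J).powerset, starWeight w v K x *
        ‖rootedSum w (A.erase v) (J.erase v ∪ K) x‖ₑ := by
  rw [rootedSum_eq w hw hJA hv, enorm_mul]
  refine mul_le_mul' (le_of_eq ?_) ((enorm_sum_le _ _).trans (Finset.sum_le_sum fun K _ => ?_))
  · rw [Real.enorm_eq_ofReal (Finset.prod_nonneg fun _ _ => hw0 _ _),
      ENNReal.ofReal_prod_of_nonneg fun _ _ => hw0 _ _]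
  · rw [enorm_mul]
    refine mul_le_mul' (le_of_eq ?_) le_rfl
    rw [Real.enorm_eq_ofReal_abs, Finset.abs_prod,
      ENNReal.ofReal_prod_of_nonneg fun _ _ => abs_nonneg _]
    refine Finset.prod_congr rfl fun k _ => ?_
    rw [abs_sub_comm, abs_of_nonneg (sub_nonneg.2 (hw1 _ _))]

theorem rootedSum_empty_right (w : S → S → ℝ) {A : Finset ι} (hA : A.Nonempty) (x : ι → S) :
    rootedSum w A ∅ x = 0 := by
  refine Finset.sum_eq_zero fun G hG => ?_
  obtain ⟨a, ha⟩ := hA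
  simp only [rootedGraphs, Finset.mem_filter] at hG
  obtain ⟨j, hj, -⟩ := hG.2.2 a ha
  simp at hj

theorem rootedSum_empty_empty (w : S → S → ℝ) (x : ι → S) :
    rootedSum w ∅ ∅ x = 1 := by
  have : rootedGraphs (∅ : Finset ι) ∅ = {⊥} := by
    ext G
    simp only [rootedGraphs, Finset.mem_filter, Finset.mem_univ, true_and, Finset.mem_singleton]
    constructor
    · intro h
      ext a b
      simpa using fun hab => h.1 a b hab
    · rintro rfl
      simp
  simp [rootedSum, this, pairProd]

variable [MeasurableSpace S]

theorem measurable_pairWeight {κ : Type*} {w : S → S → ℝ} (hwm : Measurable (Function.uncurry w))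
    (a b : κ) : Measurable fun z : κ → S => w (z a) (z b) := by
  have h : Measurable fun z : κ → S => (z a, z b) :=
    (measurable_pi_apply a).prodMk (measurable_pi_apply b)
  exact hwm.comp h

theorem measurable_rootedSum {w : S → S → ℝ} (hwm : Measurable (Function.uncurry w))
    (A J : Finset ι) : Measurable (rootedSum w A J) := by
  unfold rootedSum pairProd
  refine Finset.measurable_sum _ fun G _ => Finset.measurable_prod _ fun p _ => ?_
  exact (measurable_pairWeight hwm p.1 p.2).sub_const 1

theorem measurable_boltzmannWeight {w : S → S → ℝ} (hwm : Measurable (Function.uncurry w))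
    (J : Finset ι) : Measurable (boltzmannWeight w J) := by
  unfold boltzmannWeight pairProd
  refine Finset.measurable_prod _ fun p _ => ?_
  exact (measurable_pairWeight hwm p.1 p.2).ennreal_ofReal

omit [Fintype ι] in
theorem lmarginal_mul_left_of_forall {μ : ι → Measure S} {s : Finset ι} {x : ι → S}
    {F G : (ι → S) → ℝ≥0∞} (hF : ∀ z, (∀ i ∉ s, z i = x i) → F z = F x) (hG : Measurable G) :
    (∫⋯∫⁻_s, (fun z => F z * G z) ∂μ) x = F x * (∫⋯∫⁻_s, G ∂μ) x := by
  unfold lmarginal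
  rw [← lintegral_const_mul (f := fun y => G (Function.updateFinset x s y)) _
    (hG.comp measurable_updateFinset)]
  refine lintegral_congr fun y => ?_
  beta_reduce
  rw [hF _ fun i hi => by simp [Function.updateFinset, hi]]

theorem measurable_starWeight {w : S → S → ℝ} (hwm : Measurable (Function.uncurry w))
    {κ : Type*} (v : κ) (K : Finset κ) : Measurable (starWeight w v K) := by
  unfold starWeight
  refine Finset.measurable_prod _ fun k _ => ?_
  exact ((measurable_pairWeight hwm v k).const_sub 1).ennreal_ofReal

theorem measurable_phiVertex {w : S → S → ℝ} (hwm : Measurable (Function.uncurry w)) (n : ℕ)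
    (s : S) : Measurable (phiVertex w n s) := by
  unfold phiVertex
  refine (Finset.measurable_prod _ fun i _ => ?_).mul (Finset.measurable_prod _ fun p _ => ?_)
  · have h : Measurable fun y : Fin n → S => (s, y i) :=
      measurable_const.prodMk (measurable_pi_apply i)
    exact (hwm.comp h).const_sub 1
  · exact measurable_pairWeight hwm p.1 p.2

theorem lmarginal_starWeight {w : S → S → ℝ} (hw0 : ∀ s t, 0 ≤ w s t) (hw1 : ∀ s t, w s t ≤ 1)
    (hwm : Measurable (Function.uncurry w)) (μ : Measure S) [SigmaFinite μ] {v : ι} {K : Finset ι}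
    (hv : v ∉ K) (x : ι → S) :
    (∫⋯∫⁻_K, (fun z => starWeight w v K z * boltzmannWeight w K z) ∂fun _ => μ) x =
      ∫⁻ y, ENNReal.ofReal (phiVertex w K.card (x v) y) ∂Measure.pi fun _ => μ := by
  let e := K.orderEmbOfFin rfl
  let f : (Fin K.card → S) → ℝ≥0∞ := fun y => ENNReal.ofReal (phiVertex w K.card (x v) y)
  have himg : Finset.univ.image e = K := by
    rw [← Finset.coe_inj, Finset.coe_image, Finset.coe_univ, Set.image_univ]
    exact Finset.range_orderEmbOfFin K rfl
  have h1 : (∫⋯∫⁻_K, (fun z => starWeight w v K z * boltzmannWeight w K z) ∂fun _ => μ) x =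
      (∫⋯∫⁻_K, (f ∘ fun z => z ∘' e) ∂fun _ => μ) x := by
    unfold lmarginal
    refine lintegral_congr fun y => ?_
    set z := Function.updateFinset x K y with hz
    have hzv : z v = x v := by simp [hz, Function.updateFinset, hv]
    simp only [f, Function.comp_apply, ofReal_phiVertex hw0 hw1, starWeight, hzv,
      Function.dcomp]
    congr 1
    · conv_lhs => rw [← himg, Finset.prod_image e.injective.injOn]
    · unfold boltzmannWeight pairProd
      symm
      refine Finset.prod_bij (fun p _ => (e p.1, e p.2)) ?_ ?_ ?_ ?_
      · intro p hp
        rw [Finset.mem_filter] at hp ⊢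
        have : e p.1 < e p.2 := e.strictMono hp.2
        exact ⟨Finset.mem_univ _, this, this.ne, Finset.orderEmbOfFin_mem _ _ _,
          Finset.orderEmbOfFin_mem _ _ _⟩
      · rintro ⟨a, b⟩ _ ⟨a', b'⟩ _ h
        simpa using h
      · rintro ⟨a, b⟩ hp
        rw [Finset.mem_filter] at hp
        obtain ⟨-, hlt, -, ha, hb⟩ := hp
        rw [← himg, Finset.mem_image] at ha hb
        obtain ⟨a', -, rfl⟩ := ha
        obtain ⟨b', -, rfl⟩ := hb
        exact ⟨(a', b'), by simpa using hlt, rfl⟩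
      · intro p _
        rfl
  have h2 := lmarginal_image (μ := fun _ : ι => μ) e.injective Finset.univ (f := f)
    (measurable_phiVertex hwm _ _).ennreal_ofReal x
  rw [himg] at h2
  rw [h1, h2]
  exact (lintegral_eq_lmarginal_univ (μ := fun _ : Fin K.card => μ) _).symm

/-- The numerical Kirkwood–Salsburg recursion with coefficients `g`. -/
def ksCoef (g : ℕ → ℝ≥0∞) : ℕ → ℕ → ℝ≥0∞
  | 0, 0 => 1
  | 0, _ + 1 => 0
  | m + 1, n => ∑ k : Fin (n + 1), (n.choose k : ℝ≥0∞) * (g k * ksCoef g (m + k) (n - k))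
termination_by m n => m + n

theorem ksCoef_succ (g : ℕ → ℝ≥0∞) (m n : ℕ) :
    ksCoef g (m + 1) n =
      ∑ k ∈ Finset.range (n + 1), (n.choose k : ℝ≥0∞) * (g k * ksCoef g (m + k) (n - k)) := by
  rw [ksCoef, Fin.sum_univ_eq_sum_range
    (fun k => (n.choose k : ℝ≥0∞) * (g k * ksCoef g (m + k) (n - k)))]

theorem lmarginal_enorm_rootedSum_le {w : S → S → ℝ} (hw : ∀ s t, w s t = w t s)
    (hw0 : ∀ s t, 0 ≤ w s t) (hw1 : ∀ s t, w s t ≤ 1) (hwm : Measurable (Function.uncurry w))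
    (μ : Measure S) [SigmaFinite μ] (g : ℕ → ℝ≥0∞)
    (hg : ∀ k s, ∫⁻ y, ENNReal.ofReal (phiVertex w k s y) ∂Measure.pi (fun _ => μ) ≤ g k)
    (A J : Finset ι) (hJA : J ⊆ A) (x : ι → S) :
    (∫⋯∫⁻_(A \ J), (fun z => ‖rootedSum w A J z‖ₑ) ∂fun _ => μ) x ≤
      boltzmannWeight w J x * ksCoef g J.card (A \ J).card := by
  induction hn : A.card generalizing A J x with
  | zero =>
    obtain rfl := Finset.card_eq_zero.1 hn
    obtain rfl := Finset.subset_empty.1 hJA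
    simp [rootedSum_empty_empty, boltzmannWeight, pairProd, cliqueOn, ksCoef]
  | succ n ih =>
    rcases J.eq_empty_or_nonempty with rfl | ⟨v, hv⟩
    · have hA : A.Nonempty := Finset.card_pos.1 (by omega)
      simp [rootedSum_empty_right w hA, lmarginal]
    have hR : ∀ B I : Finset ι, Measurable fun z => ‖rootedSum w B I z‖ₑ :=
      fun B I => (measurable_rootedSum hwm B I).enorm
    have hS := fun K => measurable_starWeight hwm v K
    have hvA : v ∈ A := hJA hv
    obtain ⟨m, hm⟩ : ∃ m, J.card = m + 1 := ⟨J.card - 1, by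
      have := Finset.card_pos.2 ⟨v, hv⟩
      omega⟩
    have hme : (J.erase v).card = m := by rw [Finset.card_erase_of_mem hv, hm]; rfl
    have hSR : ∀ K B I : Finset ι, Measurable fun z => starWeight w v K z * ‖rootedSum w B I z‖ₑ :=
      fun K B I => (hS K).mul (hR B I)
    have key : ∀ K ∈ (A \ J).powerset,
        (∫⋯∫⁻_(A \ J), (fun z => starWeight w v K z *
          ‖rootedSum w (A.erase v) (J.erase v ∪ K) z‖ₑ) ∂fun _ => μ) x ≤
        boltzmannWeight w (J.erase v) x *
          (g K.card * ksCoef g (m + K.card) ((A \ J).card - K.card)) := by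
      intro K hK
      rw [Finset.mem_powerset] at hK
      have hvK : v ∉ K := fun h => (Finset.mem_sdiff.1 (hK h)).2 hv
      have hdisj : Disjoint (J.erase v) K := Finset.disjoint_left.2 fun a ha hb => by grind
      have hsd : A.erase v \ (J.erase v ∪ K) = (A \ J) \ K := by
        ext a
        simp only [Finset.mem_sdiff, Finset.mem_erase, Finset.mem_union]
        grind
      have hsplit : (∫⋯∫⁻_(A \ J), (fun z => starWeight w v K z *
          ‖rootedSum w (A.erase v) (J.erase v ∪ K) z‖ₑ) ∂fun _ => μ) =
          ∫⋯∫⁻_K, ∫⋯∫⁻_((A \ J) \ K), (fun z => starWeight w v K z *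
            ‖rootedSum w (A.erase v) (J.erase v ∪ K) z‖ₑ) ∂(fun _ => μ) ∂fun _ => μ := by
        rw [← lmarginal_union (fun _ => μ) _ (hSR K _ _) Finset.disjoint_sdiff,
          Finset.union_sdiff_of_subset hK]
      rw [hsplit]
      have hSB : ∀ K, Measurable fun z => starWeight w v K z * boltzmannWeight w K z :=
        fun K => (hS K).mul (measurable_boltzmannWeight hwm K)
      have hinner : (∫⋯∫⁻_((A \ J) \ K), (fun z => starWeight w v K z *
          ‖rootedSum w (A.erase v) (J.erase v ∪ K) z‖ₑ) ∂fun _ => μ) ≤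
          fun z => (boltzmannWeight w (J.erase v) z *
            ksCoef g (m + K.card) ((A \ J).card - K.card)) *
              (starWeight w v K z * boltzmannWeight w K z) := by
        intro z
        rw [lmarginal_mul_left_of_forall (F := starWeight w v K) _ (hR _ _)]
        · have h1 := ih (A.erase v) (J.erase v ∪ K)
            (fun a ha => by grind) z (by rw [Finset.card_erase_of_mem hvA, hn]; rfl)
          rw [hsd, Finset.card_union_of_disjoint hdisj, hme, Finset.card_sdiff_of_subset hK] at h1
          calc _ ≤ starWeight w v K z * (boltzmannWeight w (J.erase v) z * boltzmannWeight w K z *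
                ksCoef g (m + K.card) ((A \ J).card - K.card)) := by
                gcongr
                exact h1.trans (by gcongr; exact boltzmannWeight_union_le hw1 hdisj z)
            _ = _ := by ring
        · intro y hy
          unfold starWeight
          refine Finset.prod_congr rfl fun k hk => ?_
          rw [hy v (by grind), hy k (by grind)]
      refine (lmarginal_mono hinner x).trans ?_
      rw [lmarginal_mul_left_of_forall (F := fun z => boltzmannWeight w (J.erase v) z *
            ksCoef g (m + K.card) ((A \ J).card - K.card)) _
            (hSB K),
        lmarginal_starWeight hw0 hw1 hwm μ hvK]
      · rw [mul_assoc, mul_comm (ksCoef _ _ _)]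
        gcongr
        exact hg _ _
      · intro y hy
        rw [boltzmannWeight_congr w fun a ha => hy a (Finset.disjoint_left.1 hdisj ha)]
    refine (lmarginal_mono (fun z => enorm_rootedSum_le hw hw0 hw1 hJA hv z) x).trans ?_
    rw [lmarginal_mul_left_of_forall
      (F := fun z => ∏ j ∈ J.erase v, ENNReal.ofReal (w (z v) (z j))) _
      (Finset.measurable_sum _ fun K _ => hSR K _ _)]
    · have hsum : (∫⋯∫⁻_(A \ J), (fun z => ∑ K ∈ (A \ J).powerset, starWeight w v K z *
          ‖rootedSum w (A.erase v) (J.erase v ∪ K) z‖ₑ) ∂fun _ => μ) x =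
          ∑ K ∈ (A \ J).powerset, (∫⋯∫⁻_(A \ J), (fun z => starWeight w v K z *
            ‖rootedSum w (A.erase v) (J.erase v ∪ K) z‖ₑ) ∂fun _ => μ) x := by
        unfold lmarginal
        exact lintegral_finsetSum _ fun K _ =>
          (hSR K _ _).comp measurable_updateFinset
      rw [hsum]
      have hins := boltzmannWeight_insert hw (Finset.notMem_erase v J) x
      rw [Finset.insert_erase hv] at hins
      rw [hins, mul_assoc]
      refine mul_le_mul' le_rfl ((Finset.sum_le_sum key).trans (le_of_eq ?_))
      rw [← Finset.mul_sum, Finset.sum_powerset_apply_card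
        (fun k => g k * ksCoef g (m + k) ((A \ J).card - k)), hm, ksCoef_succ]
      simp only [nsmul_eq_mul]
    · intro y hy
      refine Finset.prod_congr rfl fun k hk => ?_
      rw [hy v (by grind), hy k (by grind)]

end KirkwoodSalsburg

section Majorant

theorem choose_mul_inv_factorial {n k : ℕ} (hk : k ≤ n) :
    (n.choose k : ℝ≥0∞) * (n.factorial : ℝ≥0∞)⁻¹ =
      (k.factorial : ℝ≥0∞)⁻¹ * ((n - k).factorial : ℝ≥0∞)⁻¹ := by
  have hc : (n.choose k : ℝ≥0∞) ≠ 0 := by exact_mod_cast (Nat.choose_pos hk).ne'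
  rw [← Nat.choose_mul_factorial_mul_factorial hk]
  push_cast
  rw [ENNReal.mul_inv (Or.inr (natCast_ne_top _))
      (Or.inr (by exact_mod_cast Nat.factorial_ne_zero _)),
    ENNReal.mul_inv (Or.inl hc) (Or.inl (natCast_ne_top _)), ← mul_assoc, ← mul_assoc,
    ENNReal.mul_inv_cancel hc (natCast_ne_top _), one_mul]

theorem sum_range_sum_range_sub {M : Type*} [AddCommMonoid M] (f : ℕ → ℕ → M) (N : ℕ) :
    ∑ n ∈ Finset.range (N + 1), ∑ k ∈ Finset.range (n + 1), f k (n - k) =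
      ∑ k ∈ Finset.range (N + 1), ∑ j ∈ Finset.range (N - k + 1), f k j := by
  simp_rw [Finset.sum_sigma']
  refine Finset.sum_bij' (fun q _ => ⟨q.2, q.1 - q.2⟩) (fun q _ => ⟨q.1 + q.2, q.1⟩) ?_ ?_ ?_ ?_ ?_
  · rintro ⟨n, k⟩ h
    simp only [Finset.mem_sigma, Finset.mem_range] at h ⊢
    omega
  · rintro ⟨k, j⟩ h
    simp only [Finset.mem_sigma, Finset.mem_range] at h ⊢
    omega
  · rintro ⟨n, k⟩ h
    simp only [Finset.mem_sigma, Finset.mem_range] at h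
    have : k + (n - k) = n := by omega
    simp [this]
  · rintro ⟨k, j⟩ _
    simp
  · intro _ _
    rfl

/-- Partial sums of the majorant series are controlled by a supersolution `t` of
`t = r * Ψ(t)`. -/
theorem sum_ksCoef_le (g : ℕ → ℝ≥0∞) (r t : ℝ≥0∞)
    (h : r * ∑' k, g k * t ^ k / (k.factorial : ℝ≥0∞) ≤ t) (m N : ℕ) :
    ∑ n ∈ Finset.range (N + 1), r ^ (m + n) * ksCoef g m n * (n.factorial : ℝ≥0∞)⁻¹ ≤ t ^ m := by
  induction hs : m + N using Nat.strong_induction_on generalizing m N with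
  | _ s ih =>
    subst hs
    cases m with
    | zero =>
      rw [Finset.sum_eq_single 0]
      · simp [ksCoef]
      · intro n _ hn
        obtain ⟨n, rfl⟩ := Nat.exists_eq_succ_of_ne_zero hn
        simp [ksCoef]
      · simp
    | succ m =>
      calc ∑ n ∈ Finset.range (N + 1), r ^ (m + 1 + n) * ksCoef g (m + 1) n *
            (n.factorial : ℝ≥0∞)⁻¹
          = ∑ n ∈ Finset.range (N + 1), ∑ k ∈ Finset.range (n + 1),
              r * (g k * (k.factorial : ℝ≥0∞)⁻¹ * (r ^ (m + k + (n - k)) *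
                ksCoef g (m + k) (n - k) * ((n - k).factorial : ℝ≥0∞)⁻¹)) := by
            refine Finset.sum_congr rfl fun n _ => ?_
            rw [ksCoef_succ, Finset.mul_sum, Finset.sum_mul]
            refine Finset.sum_congr rfl fun k hk => ?_
            have hkn : k ≤ n := by
              have := Finset.mem_range.1 hk
              omega
            have e : m + k + (n - k) = m + n := by omega
            have h1 := choose_mul_inv_factorial hkn
            calc _ = r * (g k * (r ^ (m + n) * ksCoef g (m + k) (n - k) *
                  ((n.choose k : ℝ≥0∞) * (n.factorial : ℝ≥0∞)⁻¹))) := by ring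
              _ = _ := by rw [h1, e]; ring
        _ = ∑ k ∈ Finset.range (N + 1), r * (g k * (k.factorial : ℝ≥0∞)⁻¹ *
              ∑ j ∈ Finset.range (N - k + 1), r ^ (m + k + j) *
                ksCoef g (m + k) j * (j.factorial : ℝ≥0∞)⁻¹) := by
            rw [sum_range_sum_range_sub (fun k j => r * (g k * (k.factorial : ℝ≥0∞)⁻¹ *
              (r ^ (m + k + j) * ksCoef g (m + k) j * (j.factorial : ℝ≥0∞)⁻¹)))]
            simp_rw [Finset.mul_sum]
        _ ≤ ∑ k ∈ Finset.range (N + 1), r * (g k * (k.factorial : ℝ≥0∞)⁻¹ * t ^ (m + k)) := by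
            refine Finset.sum_le_sum fun k hk => ?_
            have := Finset.mem_range.1 hk
            gcongr
            exact ih (m + k + (N - k)) (by omega) _ _ rfl
        _ = t ^ m * (r * ∑ k ∈ Finset.range (N + 1), g k * t ^ k / (k.factorial : ℝ≥0∞)) := by
            simp_rw [Finset.mul_sum, div_eq_mul_inv]
            exact Finset.sum_congr rfl fun k _ => by ring
        _ ≤ t ^ (m + 1) := by
            rw [pow_succ]
            gcongr
            refine le_trans ?_ h
            gcongr
            exact ENNReal.sum_le_tsum _

end Majorant

section ClusterExpansion

theorem omegaT_eq_rootedSum {S : Type*} (w : S → S → ℝ) (n : ℕ) (x : Fin (n + 1) → S) :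
    omegaT w (n + 1) x = rootedSum w Finset.univ {0} x := by
  have h : rootedGraphs Finset.univ {(0 : Fin (n + 1))} =
      Finset.univ.filter fun G => G.Connected := by
    ext G
    simp only [rootedGraphs, Finset.mem_filter, Finset.mem_univ, implies_true, true_and,
      Finset.mem_singleton, exists_eq_left, forall_const]
    exact ⟨fun h => SimpleGraph.Connected.mk fun a b => (h a).trans (h b).symm,
      fun h a => h.preconnected a 0⟩
  unfold omegaT rootedSum pairProd
  rw [h, Finset.sum_filter]

theorem lintegral_enorm_omegaT_le {S : Type*} [MeasurableSpace S] {w : S → S → ℝ}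
    (hw : ∀ s t, w s t = w t s) (hw0 : ∀ s t, 0 ≤ w s t) (hw1 : ∀ s t, w s t ≤ 1)
    (hwm : Measurable (Function.uncurry w)) (μ : Measure S) [SigmaFinite μ] (g : ℕ → ℝ≥0∞)
    (hg : ∀ k s, ∫⁻ y, ENNReal.ofReal (phiVertex w k s y) ∂Measure.pi (fun _ => μ) ≤ g k)
    {Λ : Set S} (hΛ : MeasurableSet Λ) (n : ℕ) :
    ∫⁻ x in Set.univ.pi (fun _ : Fin (n + 1) => Λ), ‖omegaT w (n + 1) x‖ₑ
      ∂Measure.pi (fun _ => μ) ≤ μ Λ * ksCoef g 1 n := by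
  rcases isEmpty_or_nonempty S with hS | ⟨⟨s₀⟩⟩
  · rw [Measure.restrict_eq_zero.2]
    · simp
    · rw [Set.eq_empty_of_isEmpty (Set.univ.pi fun _ : Fin (n + 1) => Λ), measure_empty]
  have hR : Measurable fun z : Fin (n + 1) → S => ‖rootedSum w Finset.univ {0} z‖ₑ :=
    (measurable_rootedSum hwm _ _).enorm
  have hI : Measurable fun z : Fin (n + 1) → S => Λ.indicator (fun _ => (1 : ℝ≥0∞)) (z 0) :=
    (measurable_const.indicator hΛ).comp (measurable_pi_apply 0)
  simp_rw [omegaT_eq_rootedSum]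
  rw [← lintegral_indicator (MeasurableSet.univ_pi fun _ => hΛ)]
  calc _ ≤ ∫⁻ z : Fin (n + 1) → S, Λ.indicator (fun _ => (1 : ℝ≥0∞)) (z 0) *
          ‖rootedSum w Finset.univ {0} z‖ₑ ∂Measure.pi (fun _ => μ) := by
        refine lintegral_mono fun z => ?_
        by_cases hz : z ∈ Set.univ.pi fun _ : Fin (n + 1) => Λ
        · simp [hz, hz 0 (Set.mem_univ _)]
        · simp [hz]
    _ = (∫⋯∫⁻_{0}, (∫⋯∫⁻_Finset.univ \ {0}, (fun z : Fin (n + 1) → S =>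
          Λ.indicator (fun _ => (1 : ℝ≥0∞)) (z 0) * ‖rootedSum w Finset.univ {0} z‖ₑ)
            ∂fun _ => μ) ∂fun _ => μ) fun _ => s₀ := by
        have hIR : Measurable fun z : Fin (n + 1) → S => Λ.indicator (fun _ => (1 : ℝ≥0∞)) (z 0) *
            ‖rootedSum w Finset.univ {0} z‖ₑ := hI.mul hR
        rw [← lmarginal_union (fun _ => μ) _ hIR Finset.disjoint_sdiff,
          Finset.union_sdiff_of_subset (Finset.subset_univ _), ← lintegral_eq_lmarginal_univ]
    _ ≤ (∫⋯∫⁻_{0}, (fun z : Fin (n + 1) → S =>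
          Λ.indicator (fun _ => (1 : ℝ≥0∞)) (z 0) * ksCoef g 1 n) ∂fun _ => μ) fun _ => s₀ := by
        refine lmarginal_mono (fun z => ?_) _
        rw [lmarginal_mul_left_of_forall _ hR]
        · gcongr
          have := lmarginal_enorm_rootedSum_le hw hw0 hw1 hwm μ g hg Finset.univ
            {(0 : Fin (n + 1))} (Finset.subset_univ _) z
          refine this.trans (le_of_eq ?_)
          rw [Finset.card_sdiff_of_subset (Finset.subset_univ _), ← Finset.insert_empty,
            boltzmannWeight_insert hw (Finset.notMem_empty _)]
          simp [boltzmannWeight, pairProd, cliqueOn]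
        · intro y hy
          rw [hy 0 (by simp)]
    _ = μ Λ * ksCoef g 1 n := by
        rw [lmarginal_singleton]
        simp only [Function.update_self]
        rw [lintegral_mul_const _ (measurable_const.indicator hΛ), lintegral_indicator hΛ]
        simp

variable {d : ℕ} {β : ℝ} {φ : (Fin d → ℝ) → ℝ≥0∞}

theorem pairW_nonneg (x y : Fin d → ℝ) : 0 ≤ pairW β φ x y := by
  unfold pairW
  split_ifs
  exacts [le_rfl, (Real.exp_pos _).le]

theorem pairW_le_one (hβ : 0 ≤ β) (x y : Fin d → ℝ) : pairW β φ x y ≤ 1 := by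
  unfold pairW
  split_ifs
  · exact zero_le_one
  · exact Real.exp_le_one_iff.2 (neg_nonpos.2 (mul_nonneg hβ ENNReal.toReal_nonneg))

theorem pairW_comm (hφ : ∀ v, φ (-v) = φ v) (x y : Fin d → ℝ) :
    pairW β φ x y = pairW β φ y x := by
  unfold pairW
  rw [← neg_sub, hφ]

theorem measurable_pairW (hφ : Measurable φ) : Measurable (Function.uncurry (pairW β φ)) := by
  have h : Measurable fun p : (Fin d → ℝ) × (Fin d → ℝ) => φ (p.1 - p.2) :=
    hφ.comp (measurable_fst.sub measurable_snd)
  exact Measurable.ite (h (measurableSet_singleton ∞)) measurable_const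
    (Real.measurable_exp.comp (h.ennreal_toReal.const_mul β).neg)

theorem lintegral_phiVertex_eq_gCoef (n : ℕ) (s : Fin d → ℝ) :
    ∫⁻ y : Fin n → Fin d → ℝ, ENNReal.ofReal (phiVertex (pairW β φ) n s y)
      ∂Measure.pi (fun _ => volume) = gCoef β φ n := by
  unfold gCoef
  rw [← volume_pi, ← lintegral_add_right_eq_self _ (fun _ : Fin n => s)]
  refine lintegral_congr fun y => ?_
  congr 1
  unfold phiVertex
  congr 1
  · refine Finset.prod_congr rfl fun i _ => ?_
    simp [pairW]
  · refine Finset.prod_congr rfl fun p _ => ?_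
    simp [pairW]

theorem vertexSum_eq_tsum (t : ℝ≥0∞) :
    vertexSum β φ t = ∑' n, gCoef β φ n * t ^ n / (n.factorial : ℝ≥0∞) := by
  have h0 : gCoef β φ 0 = 1 := by
    simp [gCoef, phiVertex, volume_pi, Measure.pi_empty_univ]
  rw [tsum_eq_zero_add' ENNReal.summable]
  simp [vertexSum, h0]

end ClusterExpansion

/-- the radius of convergence of the finite-volume cluster expansion is at
least `sup_{μ>0} μ/Ψ(μ)`: the series is summable at every `z` of modulus below that sup. -/
theorem statement1 {d : ℕ} (hd : 1 ≤ d) (β : ℝ) (hβ : 0 < β)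
    (φ : (Fin d → ℝ) → ℝ≥0∞) (hφm : Measurable φ) (hφeven : ∀ v, φ (-v) = φ v)
    (hT : ∫⁻ v : Fin d → ℝ, ENNReal.ofReal (1 - pairW β φ v 0) < ∞)
    (Λ : Set (Fin d → ℝ)) (hΛ : MeasurableSet Λ) (hΛfin : volume Λ < ∞)
    (z : ℂ)
    (hz : ENNReal.ofReal ‖z‖ <
      ⨆ (μ : ℝ) (_ : 0 < μ), ENNReal.ofReal μ / vertexSum β φ (ENNReal.ofReal μ)) :
    Summable (fun n : ℕ => z ^ (n + 1) / ((n + 1).factorial : ℂ) *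
        ((∫ x in Set.univ.pi (fun _ : Fin (n + 1) => Λ),
          omegaT (pairW β φ) (n + 1) x : ℝ) : ℂ)) := by

  simp only [lt_iSup_iff] at hz
  obtain ⟨t, -, ht⟩ := hz
  have hrt := ENNReal.mul_le_of_le_div ht.le
  rw [vertexSum_eq_tsum] at hrt
  refine Summable.of_enorm (ne_top_of_le_ne_top
    (ENNReal.mul_ne_top hΛfin.ne (ENNReal.ofReal_ne_top (r := t))) ?_)
  refine ENNReal.tsum_le_of_sum_range_le fun N => ?_
  have hsum := sum_ksCoef_le (gCoef β φ) _ _ hrt 1 N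
  rw [pow_one] at hsum
  refine le_trans ?_ (mul_le_mul' le_rfl hsum)
  rw [Finset.mul_sum]
  refine (Finset.sum_le_sum fun n _ => ?_).trans
    (Finset.sum_le_sum_of_subset (Finset.range_subset_range.2 N.le_succ))
  have hbound : ‖∫ x in Set.univ.pi (fun _ : Fin (n + 1) => Λ),
      omegaT (pairW β φ) (n + 1) x‖ₑ ≤ volume Λ * ksCoef (gCoef β φ) 1 n :=
    (enorm_integral_le_lintegral_enorm _).trans
      (lintegral_enorm_omegaT_le (pairW_comm hφeven) pairW_nonneg (pairW_le_one hβ.le)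
        (measurable_pairW hφm) volume _ (fun k s => (lintegral_phiVertex_eq_gCoef k s).le) hΛ n)
  have hfac : ‖(((n + 1).factorial : ℂ))⁻¹‖ₑ ≤ (n.factorial : ℝ≥0∞)⁻¹ := by
    rw [enorm_inv (by exact_mod_cast Nat.factorial_ne_zero _), ENNReal.inv_le_inv,
      ← ofReal_norm, Complex.norm_natCast, ENNReal.ofReal_natCast]
    exact_mod_cast Nat.factorial_le n.le_succ
  rw [enorm_mul, div_eq_mul_inv, enorm_mul, enorm_pow, ofReal_norm, add_comm 1 n]
  have hcast : ∀ a : ℝ, ‖(a : ℂ)‖ₑ = ‖a‖ₑ := fun a => by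
    rw [← ofReal_norm, Complex.norm_real, ofReal_norm]
  rw [hcast]
  calc _ ≤ ‖z‖ₑ ^ (n + 1) * (n.factorial : ℝ≥0∞)⁻¹ *
        (volume Λ * ksCoef (gCoef β φ) 1 n) := by gcongr
    _ = _ := by ring
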